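/- Let N ≥ 5 be a positive integer. Then there exists no s-element subset S ⊆ [1,N] with N < 2s − 1 and r(S) = 2. -/

import Mathlib

/-- `r(S)`: the number of ordered pairs `(x,y) ∈ S × S` with `x + y ∈ S`. -/
def rval (S : Finset ℕ) : ℕ :=
  ((S ×ˢ S).filter (fun p => p.1 + p.2 ∈ S)).card

/-- The summands `x` of the representations `z = x + (z - x)` with both parts in `S`. -/
def summands (S : Finset ℕ) (z : ℕ) : Finset ℕ :=
  (Finset.Icc 1 (z - 1)).filter (fun x => x ∈ S ∧ z - x ∈ S)

/-- The `x ∈ [1, z - 1]` for which neither `x` nor `z - x` lies in `S`. -/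
def missing (S : Finset ℕ) (z : ℕ) : Finset ℕ :=
  (Finset.Icc 1 (z - 1)).filter (fun x => x ∉ S ∧ z - x ∉ S)

theorem mem_summands {S : Finset ℕ} {z x : ℕ} :
    x ∈ summands S z ↔ (1 ≤ x ∧ x ≤ z - 1) ∧ x ∈ S ∧ z - x ∈ S := by
  simp [summands]

theorem mem_missing {S : Finset ℕ} {z x : ℕ} :
    x ∈ missing S z ↔ (1 ≤ x ∧ x ≤ z - 1) ∧ x ∉ S ∧ z - x ∉ S := by
  simp [missing]

theorem sum_card_summands {S : Finset ℕ} (hS : ∀ x ∈ S, 1 ≤ x) :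
    ∑ z ∈ S, (summands S z).card = rval S := by
  unfold rval
  rw [Finset.card_eq_sum_card_fiberwise (f := fun p : ℕ × ℕ => p.1 + p.2) (t := S)]
  · refine Finset.sum_congr rfl fun z hz => ?_
    refine Finset.card_bij' (fun x _ => (x, z - x)) (fun p _ => p.1) ?_ ?_ ?_ ?_
    · intro x hx
      rw [mem_summands] at hx
      have : x + (z - x) = z := by omega
      simp [hx, this, hz]
    · rintro ⟨x, y⟩ hp
      simp only [Finset.mem_filter, Finset.mem_product] at hp
      obtain ⟨⟨⟨hx, hy⟩, -⟩, rfl⟩ := hp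
      have := hS x hx
      have := hS y hy
      rw [mem_summands]
      refine ⟨by dsimp only; omega, hx, by simpa using hy⟩
    · simp
    · rintro ⟨x, y⟩ hp
      simp only [Finset.mem_filter, Finset.mem_product] at hp
      ext <;> simp <;> omega
  · intro p hp
    simp at hp ⊢
    exact hp.2

theorem sum_card_summands_le {S T : Finset ℕ} (hS : ∀ x ∈ S, 1 ≤ x) (hT : T ⊆ S) :
    ∑ z ∈ T, (summands S z).card ≤ rval S :=
  (Finset.sum_le_sum_of_subset hT).trans (sum_card_summands hS).le

theorem two_mul_card_add_card_missing {S : Finset ℕ} (hS : ∀ x ∈ S, 1 ≤ x) (z : ℕ) :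
    2 * (S.filter (· < z)).card + (missing S z).card = (summands S z).card + (z - 1) := by
  set I := Finset.Icc 1 (z - 1) with hI
  have hA : (S.filter (· < z)).card = (I.filter (· ∈ S)).card := by
    congr 1
    ext x
    simp only [Finset.mem_filter, hI, Finset.mem_Icc]
    constructor
    · rintro ⟨hx, hxz⟩
      have := hS x hx
      exact ⟨by omega, hx⟩
    · rintro ⟨hx, hxS⟩
      exact ⟨hxS, by omega⟩
  have hB : (I.filter (fun x => z - x ∈ S)).card = (I.filter (· ∈ S)).card := by
    refine Finset.card_bij' (fun x _ => z - x) (fun x _ => z - x) ?_ ?_ ?_ ?_ <;>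
      intro x hx <;> simp only [Finset.mem_filter, hI, Finset.mem_Icc] at hx ⊢
    · exact ⟨by omega, hx.2⟩
    · have : z - (z - x) = x := by omega
      exact ⟨by omega, by rw [this]; exact hx.2⟩
    · omega
    · omega
  have hU := Finset.card_union_add_card_inter (I.filter (· ∈ S)) (I.filter (fun x => z - x ∈ S))
  rw [← Finset.filter_or, ← Finset.filter_and] at hU
  have hC := Finset.card_filter_add_card_filter_not (s := I) (fun x => x ∈ S ∨ z - x ∈ S)
  simp only [not_or] at hC
  have hIc : I.card = z - 1 := by simp [hI]
  change _ + (I.filter _).card = (I.filter _).card + _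
  omega

theorem sub_mem_summands {S : Finset ℕ} {z x : ℕ} (hx : x ∈ summands S z) :
    z - x ∈ summands S z := by
  rw [mem_summands] at hx ⊢
  have : z - (z - x) = x := by omega
  exact ⟨by omega, hx.2.2, by rw [this]; exact hx.2.1⟩

theorem two_mul_eq_of_card_summands_le_one {S : Finset ℕ} {z x : ℕ}
    (h : (summands S z).card ≤ 1) (hx : x ∈ summands S z) : 2 * x = z := by
  have := Finset.card_le_one.mp h x hx _ (sub_mem_summands hx)
  rw [mem_summands] at hx
  omega

theorem exists_max_card_filter_lt {S : Finset ℕ} (hS : S.Nonempty) :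
    ∃ m ∈ S, (∀ x ∈ S, x ≤ m) ∧ S.filter (· < m) = S.erase m := by
  refine ⟨S.max' hS, S.max'_mem hS, fun x hx => S.le_max' x hx, ?_⟩
  ext x
  simp only [Finset.mem_filter, Finset.mem_erase]
  constructor
  · rintro ⟨hx, hlt⟩
    exact ⟨hlt.ne, hx⟩
  · rintro ⟨hne, hx⟩
    exact ⟨hx, lt_of_le_of_ne (S.le_max' x hx) hne⟩

theorem filter_lt_erase {S : Finset ℕ} {m k : ℕ} (h : k ≤ m) :
    (S.erase m).filter (· < k) = S.filter (· < k) := by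
  ext x
  simp only [Finset.mem_filter, Finset.mem_erase]
  constructor
  · rintro ⟨⟨-, hx⟩, hlt⟩
    exact ⟨hx, hlt⟩
  · rintro ⟨hx, hlt⟩
    exact ⟨⟨by omega, hx⟩, hlt⟩

/-- Corollary 4.8: for `N ≥ 5`, there is no `s`-element subset `S ⊆ [1,N]` with
`N < 2s − 1` and `r(S) = 2`. -/
theorem no_rval_two' (N : ℕ) (hN : 5 ≤ N) :
    ¬ ∃ (s : ℕ) (S : Finset ℕ), S ⊆ Finset.Icc 1 N ∧ S.card = s ∧
      N < 2 * s - 1 ∧ rval S = 2 := by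
  rintro ⟨s, S, hSN, hs, hNs, hr⟩
  have hS : ∀ x ∈ S, 1 ≤ x := fun x hx => (Finset.mem_Icc.mp (hSN hx)).1
  have count := two_mul_card_add_card_missing hS
  -- the three largest elements `m > m₁ > m₂`
  obtain ⟨m, hm, hmax, hc⟩ := exists_max_card_filter_lt (S := S)
    (Finset.card_pos.mp (by omega))
  have hmN : m ≤ N := (Finset.mem_Icc.mp (hSN hm)).2
  have hcm : (S.erase m).card = s - 1 := by rw [Finset.card_erase_of_mem hm, hs]
  obtain ⟨m₁, hm₁, hmax₁, hc₁⟩ := exists_max_card_filter_lt (S := S.erase m)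
    (Finset.card_pos.mp (by omega))
  have hcm₁ : ((S.erase m).erase m₁).card = s - 2 := by
    rw [Finset.card_erase_of_mem hm₁, hcm]; omega
  obtain ⟨m₂, hm₂, -, hc₂⟩ := exists_max_card_filter_lt (S := (S.erase m).erase m₁)
    (Finset.card_pos.mp (by omega))
  have hcm₂ : (((S.erase m).erase m₁).erase m₂).card = s - 3 := by
    rw [Finset.card_erase_of_mem hm₂, hcm₁]; omega
  have hlt₂ : m₂ < m₁ := lt_of_le_of_ne (hmax₁ _ (Finset.mem_of_mem_erase hm₂))
    (Finset.ne_of_mem_erase hm₂)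
  have hm₂S : m₂ ∈ S := Finset.mem_of_mem_erase (Finset.mem_of_mem_erase hm₂)
  have hm₁S : m₁ ∈ S := Finset.mem_of_mem_erase hm₁
  have hlt₁ : m₁ < m := lt_of_le_of_ne (hmax _ hm₁S) (Finset.ne_of_mem_erase hm₁)
  rw [filter_lt_erase hlt₁.le] at hc₁
  rw [filter_lt_erase hlt₂.le, filter_lt_erase (by omega)] at hc₂
  have e := count m
  have e₁ := count m₁
  have e₂ := count m₂
  rw [hc, hcm] at e
  rw [hc₁, hcm₁] at e₁
  rw [hc₂, hcm₂] at e₂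
  have p₂ := hS m₂ hm₂S
  have pair : ∀ a ∈ S, ∀ b ∈ S, a ≠ b →
      (summands S a).card + (summands S b).card ≤ 2 := by
    intro a ha b hb hab
    have := sum_card_summands_le (T := {a, b}) hS (by simp [Finset.insert_subset_iff, *])
    rwa [Finset.sum_pair hab, hr] at this
  have triple : (summands S m).card + (summands S m₁).card + (summands S m₂).card ≤ 2 := by
    have := sum_card_summands_le (T := {m, m₁, m₂}) hS (by simp [Finset.insert_subset_iff, *])
    rw [Finset.sum_insert (by simp; omega), Finset.sum_pair (by omega), hr] at this
    omega
  have gap : ∀ x ∈ S, m₁ < x → x = m := by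
    intro x hx hlt
    by_contra hne
    have := hmax₁ x (Finset.mem_erase.mpr ⟨hne, hx⟩)
    omega
  by_cases hm₁m : m₁ ≤ m - 2
  · have hmiss : missing S m = ∅ := Finset.card_eq_zero.mp (by omega)
    have h1 : 1 ∈ S := by
      by_contra h1
      have : 1 ∈ missing S m := by
        rw [mem_missing]
        exact ⟨by omega, h1, fun h => by have := gap _ h (by omega); omega⟩
      simp [hmiss] at this
    have h2 : 1 ∈ summands S m₁ := by
      rw [mem_summands]
      refine ⟨by omega, h1, ?_⟩
      have : m₁ - 1 = m₂ := by omega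
      rwa [this]
    have := two_mul_eq_of_card_summands_le_one (by omega) h2
    omega
  obtain rfl : m₁ = m - 1 := by omega
  by_cases h1 : 1 ∈ S
  · have hmem : 1 ∈ summands S m := by
      rw [mem_summands]
      exact ⟨by omega, h1, hm₁S⟩
    have hg : 2 ≤ (summands S m).card := by
      by_contra hlt
      have := two_mul_eq_of_card_summands_le_one (by omega) hmem
      omega
    have zero : ∀ z ∈ S, z ≠ m → summands S z = ∅ := by
      intro z hz hne
      have := pair z hz m hm hne
      exact Finset.card_eq_zero.mp (by omega)
    have no_succ : ∀ x ∈ S, x + 1 ≠ m → x + 1 ∉ S := by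
      intro x hx hne hx1
      have : 1 ∈ summands S (x + 1) := by
        rw [mem_summands]
        have := hS x hx
        exact ⟨by omega, h1, by simpa using hx⟩
      simp [zero _ hx1 hne] at this
    have h2 : 2 ∉ S := no_succ 1 h1 (by omega)
    have hne : m₂ ≠ m - 2 := by
      intro h
      have := no_succ m₂ hm₂S (by omega)
      have h' : m₂ + 1 = m - 1 := by omega
      exact this (h' ▸ hm₁S)
    have hm2 : m - 2 ∉ S := by
      intro h
      have := no_succ (m - 2) h (by omega)
      have h' : m - 2 + 1 = m - 1 := by omega
      exact this (h' ▸ hm₁S)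
    have a : 2 ∈ missing S m := by
      rw [mem_missing]
      exact ⟨by omega, h2, hm2⟩
    have b : m - 2 ∈ missing S m := by
      rw [mem_missing]
      have : m - (m - 2) = 2 := by omega
      exact ⟨by omega, hm2, by rwa [this]⟩
    have := Finset.card_le_one.mp (by omega) _ a _ b
    omega
  have hm2s : m = 2 * (s - 1) := by omega
  have hg₁ : summands S (m - 1) = ∅ := by
    by_contra hne
    obtain ⟨x, hx⟩ := Finset.nonempty_iff_ne_empty.mpr hne
    have := two_mul_eq_of_card_summands_le_one (by omega) hx
    omega
  have hmiss₁ : missing S (m - 1) = ∅ := by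
    rw [hg₁, Finset.card_empty] at e₁
    exact Finset.card_eq_zero.mp (by omega)
  have refl₁ : ∀ x, 1 ≤ x → x ≤ m - 2 → x ∉ S → m - 1 - x ∈ S := by
    intro x hx hxm hxS
    by_contra h
    have : x ∈ missing S (m - 1) := by
      rw [mem_missing]
      exact ⟨by omega, hxS, h⟩
    simp [hmiss₁] at this
  obtain ⟨h, rfl⟩ : ∃ h, s = h + 1 := ⟨s - 1, by omega⟩
  obtain rfl : m = 2 * h := by omega
  by_cases hg : (summands S (2 * h)).card ≤ 1
  · obtain ⟨x, hx⟩ : (summands S (2 * h)).Nonempty := Finset.card_pos.mp (by omega)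
    have low : ∀ x, 1 ≤ x → x < h → x ∉ S := by
      intro x hx
      induction x, hx using Nat.le_induction with
      | base => exact fun _ => h1
      | succ x hx ih =>
        intro hlt hxS
        have h2 := refl₁ x hx (by omega) (ih (by omega))
        have h3 : x + 1 ∈ summands S (2 * h) := by
          rw [mem_summands]
          have : 2 * h - (x + 1) = 2 * h - 1 - x := by omega
          exact ⟨by omega, hxS, by rwa [this]⟩
        have := two_mul_eq_of_card_summands_le_one hg h3
        omega
    have low' : ∀ x ∈ S, h ≤ x := by
      intro x hx
      by_contra hlt
      exact low x (hS x hx) (by omega) hx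
    have : rval S ≤ 1 := by
      refine Finset.card_le_one_iff_subset_singleton.mpr ⟨(h, h), ?_⟩
      rintro ⟨x, y⟩ hp
      simp only [Finset.mem_filter, Finset.mem_product] at hp
      have := low' x hp.1.1
      have := low' y hp.1.2
      have := hmax _ hp.2
      simp only [Finset.mem_singleton, Prod.mk.injEq]
      omega
    omega
  · have h2 : 2 * h - 2 ∈ S := by
      have := refl₁ 1 (by omega) (by omega) h1
      have h' : 2 * h - 1 - 1 = 2 * h - 2 := by omega
      rwa [h'] at this
    have hpred : h - 1 ∉ S := by
      intro hh
      have : h - 1 ∈ summands S (2 * h - 2) := by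
        rw [mem_summands]
        have h' : 2 * h - 2 - (h - 1) = h - 1 := by omega
        exact ⟨by omega, hh, by rwa [h']⟩
      have := Finset.card_pos.mpr ⟨_, this⟩
      have := pair _ h2 _ hm (by omega)
      omega
    have hh : h ∈ S := by
      have := refl₁ (h - 1) (by omega) (by omega) hpred
      have h' : 2 * h - 1 - (h - 1) = h := by omega
      rwa [h'] at this
    have hmem : h ∈ summands S (2 * h) := by
      rw [mem_summands]
      have h' : 2 * h - h = h := by omega
      exact ⟨by omega, hh, by rwa [h']⟩
    obtain ⟨a, b, hab, hF⟩ := Finset.card_eq_two.mp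
      (show (summands S (2 * h)).card = 2 by omega)
    have ha := sub_mem_summands (S := S) (z := 2 * h) (x := a) (by simp [hF])
    have hb := sub_mem_summands (S := S) (z := 2 * h) (x := b) (by simp [hF])
    rw [hF] at hmem ha hb
    simp only [Finset.mem_insert, Finset.mem_singleton] at hmem ha hb
    omega
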